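/- arXiv:1409.8141 — 2 statements merged into one kernel-verified Lean document; each statement's English description precedes it below -/
import Mathlib

section
/- Let k ≥ 5 be an integer and let G be a triangle-free simple graph on n vertices that contains at least ⌊n/k⌋ pairwise vertex-disjoint 5-cycles. Then the number of edges of G is at most ((k² − 2k + 5)/(4k²))·n² + n. -/
/-- `c` describes a 5-cycle in `G`: five distinct vertices that are cyclically adjacent. -/
def SimpleGraph.IsC5 {V : Type*} (G : SimpleGraph V) (c : Fin 5 → V) : Prop :=
  Function.Injective c ∧ ∀ i : Fin 5, G.Adj (c i) (c (i + 1))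

/-- In a triangle-free graph, a vertex has at most two neighbours on a 5-cycle. -/
theorem SimpleGraph.IsC5.sum_adj_le_two {V : Type*} {G : SimpleGraph V} [DecidableRel G.Adj]
    (hG : G.CliqueFree 3) {c : Fin 5 → V} (hc : G.IsC5 c) (x : V) :
    ∑ i, (if G.Adj x (c i) then 1 else 0) ≤ 2 := by
  classical
  have consecutive (i : Fin 5) : ¬ (G.Adj x (c i) ∧ G.Adj x (c (i + 1))) := fun h =>
    hG _ (SimpleGraph.is3Clique_triple_iff.2 ⟨h.1, h.2, hc.2 i⟩)
  have h0 := consecutive 0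
  have h1 := consecutive 1
  have h2 := consecutive 2
  have h3 := consecutive 3
  have h4 := consecutive 4
  simp only [Fin.isValue, Fin.reduceAdd, zero_add] at h0 h1 h2 h3 h4
  rw [Fin.sum_univ_five]
  split_ifs <;> simp_all

/-- Mantel's theorem for the subgraph induced on `W`, as a bound on the number of ordered
adjacent pairs. -/
theorem SimpleGraph.CliqueFree.two_mul_sum_adj_le_sq {V : Type*} {G : SimpleGraph V}
    [DecidableRel G.Adj] (hG : G.CliqueFree 3) (W : Finset V) :
    2 * ∑ x ∈ W, ∑ y ∈ W, (if G.Adj x y then 1 else 0) ≤ W.card ^ 2 := by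
  classical
  let H := G.comap ((↑) : W → V)
  have hfree : H.CliqueFree (2 + 1) := hG.comap ⟨(SimpleGraph.Embedding.comap (Function.Embedding.subtype _) G).toCopy⟩
  have mantel := hfree.card_edgeFinset_le
  have hdeg : ∑ x ∈ W, ∑ y ∈ W, (if G.Adj x y then 1 else 0) = ∑ v : W, H.degree v := by
    rw [← Finset.sum_coe_sort W]
    refine Finset.sum_congr rfl fun x _ => ?_
    rw [← Finset.sum_coe_sort W, ← SimpleGraph.card_neighborFinset_eq_degree,
      SimpleGraph.neighborFinset_eq_filter, Finset.card_filter]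
    rfl
  rw [hdeg, H.sum_degrees_eq_twice_card_edges]
  have hchoose : (W.card % 2).choose 2 = 0 :=
    Nat.choose_eq_zero_of_lt (Nat.mod_lt _ two_pos)
  simp only [Fintype.card_coe, hchoose] at mantel
  omega

/-- A triangle-free graph with `t` disjoint 5-cycles and `m` further vertices has at most
`m² / 4 + 2tm + 5t²` edges. -/
theorem SimpleGraph.CliqueFree.four_mul_card_edgeFinset_le_of_disjoint_C5s
    {V : Type*} [Fintype V] [DecidableEq V]
    {G : SimpleGraph V} [DecidableRel G.Adj] (hG : G.CliqueFree 3) {t : ℕ}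
    (c : Fin t → Fin 5 → V) (hc : ∀ m, G.IsC5 (c m))
    (hdisj : ∀ m l : Fin t, m ≠ l → ∀ i j : Fin 5, c m i ≠ c l j) :
    ∃ m, Fintype.card V = 5 * t + m ∧
      4 * G.edgeFinset.card ≤ m ^ 2 + 8 * t * m + 20 * t ^ 2 := by
  have hinj : Function.Injective fun p : Fin t × Fin 5 => c p.1 p.2 := by
    rintro ⟨m, i⟩ ⟨l, j⟩ h
    obtain rfl : m = l := by
      by_contra hml
      exact hdisj m l hml i j h
    exact congrArg _ ((hc m).1 h)
  let U : Finset V := Finset.univ.image fun p : Fin t × Fin 5 => c p.1 p.2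
  have hU : U.card = 5 * t := by
    simp [U, Finset.card_image_of_injective _ hinj, mul_comm]
  have hdegU (x : V) : ∑ y ∈ U, (if G.Adj x y then 1 else 0) ≤ 2 * t := by
    rw [Finset.sum_image hinj.injOn, Fintype.sum_prod_type]
    calc _ ≤ ∑ _m : Fin t, 2 := Finset.sum_le_sum fun m _ => (hc m).sum_adj_le_two hG x
      _ = 2 * t := by simp [mul_comm]
  have hfromU (S : Finset V) :
      ∑ x ∈ S, ∑ y ∈ U, (if G.Adj x y then 1 else 0) ≤ S.card * (2 * t) :=
    Finset.sum_le_card_nsmul _ _ _ fun x _ => hdegU x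
  have hswap : ∑ x ∈ U, ∑ y ∈ Uᶜ, (if G.Adj x y then 1 else 0)
      = ∑ x ∈ Uᶜ, ∑ y ∈ U, (if G.Adj x y then 1 else 0) := by
    rw [Finset.sum_comm]
    simp only [G.adj_comm]
  have htotal : 2 * G.edgeFinset.card = ∑ x, ∑ y, (if G.Adj x y then 1 else 0) := by
    rw [← G.sum_degrees_eq_twice_card_edges]
    refine Finset.sum_congr rfl fun x _ => ?_
    rw [← SimpleGraph.card_neighborFinset_eq_degree, SimpleGraph.neighborFinset_eq_filter,
      Finset.card_filter]
  simp only [← Finset.sum_add_sum_compl U, Finset.sum_add_distrib] at htotal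
  have hUU := hfromU U
  have hWU := hfromU Uᶜ
  have hWW := hG.two_mul_sum_adj_le_sq Uᶜ
  refine ⟨Uᶜ.card, by rw [← hU, Finset.card_add_card_compl], ?_⟩
  rw [hU] at hUU
  nlinarith

/-- If `k ≥ 5` and `G` is a triangle-free graph on `n` vertices containing at least `⌊n/k⌋`
pairwise vertex-disjoint 5-cycles, then `G` has at most `((k² − 2k + 5)/(4k²))·n² + n` edges. -/
theorem edge_bound_of_many_C5s {V : Type*} [Fintype V] [DecidableEq V]
    {G : SimpleGraph V} [DecidableRel G.Adj] (hG : G.CliqueFree 3)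
    {k n : ℕ} (hk : 5 ≤ k) (hn : Fintype.card V = n)
    (c : Fin (n / k) → Fin 5 → V) (hc : ∀ m, G.IsC5 (c m))
    (hdisj : ∀ m l : Fin (n / k), m ≠ l → ∀ i j : Fin 5, c m i ≠ c l j) :
    (G.edgeFinset.card : ℝ) ≤ ((k ^ 2 - 2 * k + 5) / (4 * k ^ 2)) * n ^ 2 + n := by
  have hk0 : (0 : ℝ) < k := by exact_mod_cast (by omega : 0 < k)
  obtain ⟨m, hm, hedges⟩ := hG.four_mul_card_edgeFinset_le_of_disjoint_C5s c hc hdisj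
  have hdiv : ((n / k : ℕ) : ℝ) ≤ n / k := Nat.cast_div_le
  have hlt : (n : ℝ) / k < (n / k : ℕ) + 1 := by
    rw [div_lt_iff₀ hk0]
    exact_mod_cast (Nat.lt_mul_of_div_lt (Nat.lt_succ_self (n / k)) (by omega))
  generalize n / k = t at *
  have hm' : (m : ℝ) = n - 5 * t := by
    rw [← hn, hm]
    push_cast
    ring
  have hedges' : 4 * (G.edgeFinset.card : ℝ) ≤ m ^ 2 + 8 * t * m + 20 * t ^ 2 := by
    exact_mod_cast hedges
  rw [hm'] at hedges'
  have hrhs : (((k : ℝ) ^ 2 - 2 * k + 5) / (4 * k ^ 2)) * n ^ 2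
      = (n ^ 2 - 2 * n * (n / k) + 5 * (n / k) ^ 2) / 4 := by
    field_simp
  rw [hrhs]
  have ht : (0 : ℝ) ≤ t := t.cast_nonneg
  have hn0 : (0 : ℝ) ≤ n := n.cast_nonneg
  generalize (n : ℝ) / k = s at *
  have hloss : (0 : ℝ) ≤ n * (1 - (s - t)) := mul_nonneg hn0 (by linarith)
  have hgain : 0 ≤ (s - t) * (s + t) := mul_nonneg (by linarith) (by linarith)
  nlinarith
end

section
/- Let G be a triangle-free simple graph containing nine distinct vertices u1, u2, u3, u4, v1, v2, v3, v4, w such that u1u2, u2u3, u3u4, u4u1 form a 4-cycle, v1v2, v2v3, v3v4, v4v1 form a vertex-disjoint 4-cycle, wu1 is an edge, and there is exactly one further edge e of G joining some vertex of {v1,v2,v3,v4} to some vertex of {w, u1, u2, u3, u4}. Suppose the only edges of G incident to w are wu1 and possibly e, and the only edges of G incident to any of v1, v2, v3, v4 are the four cycle edges among them and e. Then there exist two non-adjacent vertices x, y among these nine vertices such that the graph obtained from G by adding the edge xy is still triangle-free and contains a 5-cycle all of whose vertices lie among these nine vertices. -/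
namespace SimpleGraph

variable {V : Type*} {G : SimpleGraph V}

/-- Joining two vertices without common neighbours creates no triangle. -/
theorem CliqueFree.sup_fromEdgeSet_of_no_common_neighbor (hG : G.CliqueFree 3) {x y : V}
    (hcommon : ∀ z, G.Adj x z → ¬ G.Adj y z) :
    (G ⊔ fromEdgeSet {s(x, y)}).CliqueFree 3 := by
  classical
  intro s hs
  obtain ⟨a, b, c, hab, hac, hbc, -⟩ := is3Clique_iff.mp hs
  have htri : ∀ a b c, G.Adj a b → G.Adj a c → ¬ G.Adj b c := fun a b c h₁ h₂ h₃ =>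
    hG {a, b, c} (is3Clique_triple_iff.mpr ⟨h₁, h₂, h₃⟩)
  simp only [sup_adj, fromEdgeSet_adj, Set.mem_singleton_iff, Sym2.eq_iff] at hab hac hbc
  grind [adj_comm]

/-- Closing a path on five vertices of `S` whose ends have no common neighbour yields a
triangle-free graph with a 5-cycle inside `S`. -/
theorem CliqueFree.exists_isC5_of_path (hG : G.CliqueFree 3) {S : Set V} {x₀ x₁ x₂ x₃ x₄ : V}
    (hnodup : [x₀, x₁, x₂, x₃, x₄].Nodup) (hS : ∀ x ∈ [x₀, x₁, x₂, x₃, x₄], x ∈ S)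
    (h₀₁ : G.Adj x₀ x₁) (h₁₂ : G.Adj x₁ x₂) (h₂₃ : G.Adj x₂ x₃) (h₃₄ : G.Adj x₃ x₄)
    (hnadj : ¬ G.Adj x₀ x₄) (hcommon : ∀ z, G.Adj x₀ z → ¬ G.Adj x₄ z) :
    ∃ x ∈ S, ∃ y ∈ S, x ≠ y ∧ ¬ G.Adj x y ∧
      (G ⊔ fromEdgeSet {s(x, y)}).CliqueFree 3 ∧
      ∃ c : Fin 5 → V, (G ⊔ fromEdgeSet {s(x, y)}).IsC5 c ∧ ∀ i : Fin 5, c i ∈ S := by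
  have hne : x₀ ≠ x₄ := by grind
  refine ⟨x₀, hS _ (by simp), x₄, hS _ (by simp), hne, hnadj,
    hG.sup_fromEdgeSet_of_no_common_neighbor hcommon, ![x₀, x₁, x₂, x₃, x₄],
    ⟨?_, ?_⟩, ?_⟩
  · exact List.nodup_ofFn.mp hnodup
  · intro i
    fin_cases i <;> simp [h₀₁, h₁₂, h₂₃, h₃₄, hne.symm]
  · intro i
    fin_cases i <;> simp [hS]

/-- The configuration with the second 4-cycle labelled `a p q r`, where `a` is the vertex
joined to the rest. -/
theorem CliqueFree.exists_isC5_of_two_C4s (hG : G.CliqueFree 3) {S : Set V}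
    {u1 u2 u3 u4 a p q r w b : V} (hnodup : [u1, u2, u3, u4, a, p, q, r, w].Nodup)
    (hS : ∀ x ∈ [u1, u2, u3, u4, a, p, q, r, w], x ∈ S)
    (hu12 : G.Adj u1 u2) (hu23 : G.Adj u2 u3) (hu34 : G.Adj u3 u4) (hu41 : G.Adj u4 u1)
    (hap : G.Adj a p) (hpq : G.Adj p q) (hw : G.Adj w u1)
    (hb : b = w ∨ b = u1 ∨ b = u2 ∨ b = u3 ∨ b = u4) (hab : G.Adj a b)
    (hau : G.Adj a u1 → u1 = b)
    (hwN : ∀ x, G.Adj w x → x = u1 ∨ (b = w ∧ x = a))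
    (hpN : ∀ x, G.Adj p x → x = a ∨ x = q) (hqN : ∀ x, G.Adj q x → x = p ∨ x = r)
    (hrN : ∀ x, G.Adj r x → x = a ∨ x = q) :
    ∃ x ∈ S, ∃ y ∈ S, x ≠ y ∧ ¬ G.Adj x y ∧
      (G ⊔ fromEdgeSet {s(x, y)}).CliqueFree 3 ∧
      ∃ c : Fin 5 → V, (G ⊔ fromEdgeSet {s(x, y)}).IsC5 c ∧ ∀ i : Fin 5, c i ∈ S := by
  simp only [List.nodup_cons, List.mem_cons, List.not_mem_nil, or_false, not_or] at hnodup
  rcases hb with rfl | rfl | rfl | rfl | rfl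
  · apply hG.exists_isC5_of_path (x₀ := u1) (x₁ := b) (x₂ := a) (x₃ := p) (x₄ := q) <;>
      grind [adj_comm]
  · apply hG.exists_isC5_of_path (x₀ := w) (x₁ := b) (x₂ := a) (x₃ := p) (x₄ := q) <;>
      grind [adj_comm]
  · apply hG.exists_isC5_of_path (x₀ := w) (x₁ := u1) (x₂ := b) (x₃ := a) (x₄ := p) <;>
      grind [adj_comm]
  · apply hG.exists_isC5_of_path (x₀ := u1) (x₁ := u2) (x₂ := b) (x₃ := a) (x₄ := p) <;>
      grind [adj_comm]
  · apply hG.exists_isC5_of_path (x₀ := w) (x₁ := u1) (x₂ := b) (x₃ := a) (x₄ := p) <;>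
      grind [adj_comm]

end SimpleGraph

/-- Two vertex-disjoint 4-cycles `u₁u₂u₃u₄` and `v₁v₂v₃v₄` with a pendant vertex `w`
attached to `u₁`, and exactly one further edge `e` joining the (otherwise clean) second
4-cycle to the rest of the configuration; `w` is otherwise untouched as well.  Then some
edge between two non-adjacent vertices of the configuration can be added so that the graph
stays triangle-free and acquires a 5-cycle inside the configuration. -/
theorem complete_C5_from_two_C4s_and_pendant {V : Type*} {G : SimpleGraph V}
    (hG : G.CliqueFree 3)
    (u1 u2 u3 u4 v1 v2 v3 v4 w : V)
    (hdist : List.Pairwise (· ≠ ·) [u1, u2, u3, u4, v1, v2, v3, v4, w])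
    (hu12 : G.Adj u1 u2) (hu23 : G.Adj u2 u3) (hu34 : G.Adj u3 u4) (hu41 : G.Adj u4 u1)
    (hv12 : G.Adj v1 v2) (hv23 : G.Adj v2 v3) (hv34 : G.Adj v3 v4) (hv41 : G.Adj v4 v1)
    (hw : G.Adj w u1)
    (hjoin : ∃ a ∈ ({v1, v2, v3, v4} : Set V), ∃ b ∈ ({w, u1, u2, u3, u4} : Set V),
      G.Adj a b ∧
      (∀ a' ∈ ({v1, v2, v3, v4} : Set V), ∀ b' ∈ ({w, u1, u2, u3, u4} : Set V),
        G.Adj a' b' → a' = a ∧ b' = b) ∧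
      (∀ x : V, G.Adj w x → x = u1 ∨ (b = w ∧ x = a)) ∧
      (∀ y ∈ ({v1, v2, v3, v4} : Set V), ∀ x : V, G.Adj y x →
        (y = v1 ∧ (x = v2 ∨ x = v4)) ∨ (y = v2 ∧ (x = v1 ∨ x = v3)) ∨
        (y = v3 ∧ (x = v2 ∨ x = v4)) ∨ (y = v4 ∧ (x = v3 ∨ x = v1)) ∨
        (y = a ∧ x = b))) :
    ∃ x ∈ ({u1, u2, u3, u4, v1, v2, v3, v4, w} : Set V),
      ∃ y ∈ ({u1, u2, u3, u4, v1, v2, v3, v4, w} : Set V),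
      x ≠ y ∧ ¬ G.Adj x y ∧
      (G ⊔ SimpleGraph.fromEdgeSet {s(x, y)}).CliqueFree 3 ∧
      ∃ c : Fin 5 → V, (G ⊔ SimpleGraph.fromEdgeSet {s(x, y)}).IsC5 c ∧
        ∀ i : Fin 5, c i ∈ ({u1, u2, u3, u4, v1, v2, v3, v4, w} : Set V) := by
  obtain ⟨a, ha, b, hb, hab, huniq, hwN, hvN⟩ := hjoin
  simp only [Set.mem_insert_iff, Set.mem_singleton_iff] at ha hb huniq hvN
  have hau : G.Adj a u1 → u1 = b := fun h => (huniq a ha u1 (by simp) h).2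
  have hN1 := hvN v1 (by simp)
  have hN2 := hvN v2 (by simp)
  have hN3 := hvN v3 (by simp)
  have hN4 := hvN v4 (by simp)
  have hnodup : [u1, u2, u3, u4, v1, v2, v3, v4, w].Nodup := hdist
  simp only [List.nodup_cons, List.mem_cons, List.not_mem_nil, or_false, not_or] at hnodup
  rcases ha with rfl | rfl | rfl | rfl
  · refine hG.exists_isC5_of_two_C4s (r := v4) ?_ (by simp) hu12 hu23 hu34 hu41
      hv12 hv23 hw hb hab hau hwN (by grind) (by grind) (by grind)
    simp only [List.nodup_cons, List.mem_cons, List.not_mem_nil, or_false, not_or]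
    grind
  · refine hG.exists_isC5_of_two_C4s (r := v1) ?_ (by simp) hu12 hu23 hu34 hu41
      hv23 hv34 hw hb hab hau hwN (by grind) (by grind) (by grind)
    simp only [List.nodup_cons, List.mem_cons, List.not_mem_nil, or_false, not_or]
    grind
  · refine hG.exists_isC5_of_two_C4s (r := v2) ?_ (by simp) hu12 hu23 hu34 hu41
      hv34 hv41 hw hb hab hau hwN (by grind) (by grind) (by grind)
    simp only [List.nodup_cons, List.mem_cons, List.not_mem_nil, or_false, not_or]
    grind
  · refine hG.exists_isC5_of_two_C4s (r := v3) ?_ (by simp) hu12 hu23 hu34 hu41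
      hv41 hv12 hw hb hab hau hwN (by grind) (by grind) (by grind)
    simp only [List.nodup_cons, List.mem_cons, List.not_mem_nil, or_false, not_or]
    grind
end
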